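/- Suppose λ(X) ≠ 0 for every dense X ∈ L ∖ {V}. Then the set {Ξ(B) : B ∈ nbc}, indexed by the standard ordered nbc-bases of 𝒜, is a ℂ-basis of the top-degree part A^r of the Orlik–Solomon algebra. -/

import Mathlib

open Module

noncomputable section

/-- An arrangement of `n` (affine) hyperplanes inside the ambient affine subspace `amb`
of the complex vector space `W`.  The linear order on the hyperplanes is the order of the
indices in `Fin n`; an arbitrary linear order is encoded by a permutation `σ` of `Fin n`,
with `i ≺ j ↔ σ i < σ j`. -/
structure HArr (W : Type) [AddCommGroup W] [Module ℂ W] (n : ℕ) where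
  amb : AffineSubspace ℂ W
  amb_ne : (amb : Set W).Nonempty
  H : Fin n → AffineSubspace ℂ W
  inj : Function.Injective H
  le_amb : ∀ i, H i ≤ amb
  nonemptyH : ∀ i, ((H i : Set W)).Nonempty
  hyp : ∀ i, finrank ℂ (H i).direction + 1 = finrank ℂ amb.direction

namespace HArr

variable {W : Type} [AddCommGroup W] [Module ℂ W] {n : ℕ}

/-- The intersection `⋂ S` of a subset of the arrangement (the ambient space for `S = ∅`). -/
def inter (A : HArr W n) (S : Finset (Fin n)) : AffineSubspace ℂ W :=
  A.amb ⊓ S.inf A.H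

/-- Codimension (inside the ambient space) of an affine subspace. -/
def cd (A : HArr W n) (X : AffineSubspace ℂ W) : ℕ :=
  finrank ℂ A.amb.direction - finrank ℂ X.direction

/-- A dependent subset of the arrangement. -/
def dep (A : HArr W n) (S : Finset (Fin n)) : Prop :=
  A.inter S ≠ ⊥ ∧ A.cd (A.inter S) < S.card

/-- An independent subset of the arrangement. -/
def indep (A : HArr W n) (S : Finset (Fin n)) : Prop :=
  A.inter S ≠ ⊥ ∧ A.cd (A.inter S) = S.card

/-- A base: a maximal independent subset. -/
def isBase (A : HArr W n) (S : Finset (Fin n)) : Prop :=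
  A.indep S ∧ ∀ T, A.indep T → S ⊆ T → S = T

open scoped Classical in
/-- The rank of a subarrangement `{H i : i ∈ C}`. -/
def rankOn (A : HArr W n) (C : Finset (Fin n)) : ℕ :=
  C.powerset.sup fun S => if A.indep S then S.card else 0

/-- The rank `r` of the arrangement. -/
def rank (A : HArr W n) : ℕ := A.rankOn Finset.univ

/-- A circuit: an inclusion-minimal dependent set. -/
def circuit (A : HArr W n) (S : Finset (Fin n)) : Prop :=
  A.dep S ∧ ∀ T ⊂ S, ¬ A.dep T

/-- A broken circuit w.r.t. the linear order given by `σ`. -/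
def brokenCircuit (A : HArr W n) (σ : Equiv.Perm (Fin n)) (S : Finset (Fin n)) : Prop :=
  ∃ i ∉ S, (∀ j ∈ S, σ i < σ j) ∧ A.circuit (insert i S)

/-- An nbc set: nonempty intersection and containing no broken circuit. -/
def nbcSet (A : HArr W n) (σ : Equiv.Perm (Fin n)) (S : Finset (Fin n)) : Prop :=
  A.inter S ≠ ⊥ ∧ ∀ T ⊆ S, ¬ A.brokenCircuit σ T

/-- An nbc-base. -/
def nbcBase (A : HArr W n) (σ : Equiv.Perm (Fin n)) (S : Finset (Fin n)) : Prop :=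
  A.nbcSet σ S ∧ A.isBase S

/-- A βnbc-base. -/
def betaNbcBase (A : HArr W n) (σ : Equiv.Perm (Fin n)) (S : Finset (Fin n)) : Prop :=
  A.nbcBase σ S ∧ ∀ i ∈ S, ∃ j, σ j < σ i ∧ A.isBase (insert j (S.erase i))

/-- Membership in the intersection poset `L(𝒜)`. -/
def memL (A : HArr W n) (X : AffineSubspace ℂ W) : Prop :=
  X ≠ ⊥ ∧ ∃ S : Finset (Fin n), A.inter S = X

/-- A maximal element of `L(𝒜)` (in the reverse-inclusion order). -/
def maximalL (A : HArr W n) (X : AffineSubspace ℂ W) : Prop :=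
  A.memL X ∧ ∀ Y, A.memL Y → Y ≤ X → Y = X

open scoped Classical in
/-- The set of indices of hyperplanes containing `X`, i.e. `𝒜_X`. -/
def sub (A : HArr W n) (X : AffineSubspace ℂ W) : Finset (Fin n) :=
  Finset.univ.filter fun i => X ≤ A.H i

/-- `X` is dense: `𝒜_X` admits no decomposition into two nonempty parts. -/
def denseL (A : HArr W n) (X : AffineSubspace ℂ W) : Prop :=
  ¬ ∃ S T : Finset (Fin n), Disjoint S T ∧ S.Nonempty ∧ T.Nonempty ∧
      S ∪ T = A.sub X ∧ A.cd (A.inter S) + A.cd (A.inter T) = A.cd X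

/-- `i` is the minimum of `S` w.r.t. the linear order given by `σ`. -/
def isMin (σ : Equiv.Perm (Fin n)) (i : Fin n) (S : Finset (Fin n)) : Prop :=
  i ∈ S ∧ ∀ j ∈ S, σ i ≤ σ j

/-- The standard ordered tuple of a finite set, w.r.t. the linear order given by `σ`:
`tup σ S p` is the element of `S` with `(p+1)`-st smallest `σ`-value. -/
def tup (σ : Equiv.Perm (Fin n)) (S : Finset (Fin n)) (p : Fin S.card) : Fin n :=
  σ.symm (((S.image ⇑σ).orderIsoOfFin (Finset.card_image_of_injective S σ.injective) p).1)

/-- The flag `ξ(B) = (X_1 > ⋯ > X_r)` of a standard ordered base: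
`flag σ S p = X_{p+1} = ⋂_{k ≥ p} H_{i_k}`. -/
def flag (A : HArr W n) (σ : Equiv.Perm (Fin n)) (S : Finset (Fin n)) (p : Fin S.card) :
    AffineSubspace ℂ W :=
  A.inter (S.filter fun i => σ (tup σ S p) ≤ σ i)

/-- Lexicographic order on standard ordered tuples (for the canonical order). -/
def lexLt (S T : Finset (Fin n)) : Prop :=
  List.Lex (· < ·) (S.sort (· ≤ ·)) (T.sort (· ≤ ·))

/-- `λ(X) = Σ_{H_i ∈ 𝒜_X} λ_i`. -/
def lamX (A : HArr W n) (lam : Fin n → ℂ) (X : AffineSubspace ℂ W) : ℂ :=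
  ∑ i ∈ A.sub X, lam i

/-- `X` is unmixed (w.r.t. the order `σ`). -/
def unmixedX (A : HArr W n) (σ : Equiv.Perm (Fin n)) (X : AffineSubspace ℂ W) : Prop :=
  (∀ S, A.nbcBase σ S → A.inter S = X → A.betaNbcBase σ S) ∨
  (∀ S, A.nbcBase σ S → A.inter S = X → ¬ A.betaNbcBase σ S)

/-- The linear order given by `σ` is unmixed. -/
def unmixedOrd (A : HArr W n) (σ : Equiv.Perm (Fin n)) : Prop :=
  ∀ X, A.maximalL X → A.unmixedX σ X

/-- Membership in the intersection poset of the deleted arrangement `𝒜 ∖ {H_{i₀}}`. -/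
def memLdel (A : HArr W n) (i₀ : Fin n) (X : AffineSubspace ℂ W) : Prop :=
  X ≠ ⊥ ∧ ∃ S : Finset (Fin n), i₀ ∉ S ∧ A.inter S = X

/-- A maximal element of the intersection poset of the deleted arrangement. -/
def maximalLdel (A : HArr W n) (i₀ : Fin n) (X : AffineSubspace ℂ W) : Prop :=
  A.memLdel i₀ X ∧ ∀ Y, A.memLdel i₀ Y → Y ≤ X → Y = X

/-- The generator `e_i` of the exterior algebra `E`. -/
def gen (i : Fin n) : ExteriorAlgebra ℂ (Fin n → ℂ) :=
  ExteriorAlgebra.ι ℂ (Pi.single i 1)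

/-- `e_S = e_{i_1} ∧ ⋯ ∧ e_{i_p}` for `S = {i_1 < ⋯ < i_p}`. -/
def eS (S : Finset (Fin n)) : ExteriorAlgebra ℂ (Fin n → ℂ) :=
  ((S.sort (· ≤ ·)).map gen).prod

/-- `∂e_S = Σ_k (−1)^{k−1} e_{S ∖ {i_k}}`. -/
def bdry (S : Finset (Fin n)) : ExteriorAlgebra ℂ (Fin n → ℂ) :=
  ∑ i ∈ S, ((-1 : ℂ) ^ (S.filter fun j => j < i).card) • eS (S.erase i)

/-- The defining relations of the Orlik–Solomon algebra. -/
inductive OSRel (A : HArr W n) :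
    ExteriorAlgebra ℂ (Fin n → ℂ) → ExteriorAlgebra ℂ (Fin n → ℂ) → Prop
  | isBot : ∀ S : Finset (Fin n), A.inter S = ⊥ → OSRel A (eS S) 0
  | isDep : ∀ S : Finset (Fin n), A.dep S → OSRel A (bdry S) 0

/-- The Orlik–Solomon algebra `A(𝒜)`: the exterior algebra modulo the ideal generated by
the `e_S` with empty intersection and the `∂e_S` with `S` dependent. -/
abbrev OS (A : HArr W n) := RingQuot (OSRel A)

/-- The quotient map `E → A(𝒜)`. -/
def osMk (A : HArr W n) : ExteriorAlgebra ℂ (Fin n → ℂ) →ₐ[ℂ] OS A :=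
  RingQuot.mkAlgHom ℂ (OSRel A)

/-- `ω_i`, the image of `e_i` in the Orlik–Solomon algebra. -/
def om (A : HArr W n) (i : Fin n) : OS A := osMk A (gen i)

/-- `ω_B`, the image of `e_B` in the Orlik–Solomon algebra. -/
def omB (A : HArr W n) (S : Finset (Fin n)) : OS A := osMk A (eS S)

/-- The degree `p` part `A^p` of the Orlik–Solomon algebra. -/
def deg (A : HArr W n) (p : ℕ) : Submodule ℂ (OS A) :=
  Submodule.span ℂ {x | ∃ S : Finset (Fin n), S.card = p ∧ x = omB A S}

/-- `ω_λ = Σ_i λ_i ω_i`. -/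
def omLam (A : HArr W n) (lam : Fin n → ℂ) : OS A := ∑ i, lam i • om A i

/-- `ω_λ(X) = Σ_{H_i ∈ 𝒜_X} λ_i ω_i`. -/
def omLamX (A : HArr W n) (lam : Fin n → ℂ) (X : AffineSubspace ℂ W) : OS A :=
  ∑ i ∈ A.sub X, lam i • om A i

/-- The form `Ξ(B) = ω_λ(X_1) ⋯ ω_λ(X_r)` attached to a standard ordered base. -/
def Xi (A : HArr W n) (σ : Equiv.Perm (Fin n)) (lam : Fin n → ℂ) (S : Finset (Fin n)) :
    OS A :=
  ((List.finRange S.card).map fun p => A.omLamX lam (A.flag σ S p)).prod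

/-- The submodule `ω_λ ∧ A^p` of the Orlik-Solomon algebra. -/
def Ideg (A : HArr W n) (lam : Fin n → ℂ) (p : ℕ) : Submodule ℂ (OS A) :=
  (A.deg p).map (LinearMap.mulLeft ℂ (A.omLam lam))

end HArr

namespace HArr

section Exterior

variable {n : ℕ}

/-- Contraction of the exterior algebra on `Fin n → ℂ` with a linear form. -/
abbrev contr (d : Module.Dual ℂ (Fin n → ℂ)) :
    ExteriorAlgebra ℂ (Fin n → ℂ) →ₗ[ℂ] ExteriorAlgebra ℂ (Fin n → ℂ) :=
  CliffordAlgebra.contractLeft (Q := (0 : QuadraticForm ℂ (Fin n → ℂ))) d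

theorem contr_ι_mul (d : Module.Dual ℂ (Fin n → ℂ)) (v : Fin n → ℂ)
    (x : ExteriorAlgebra ℂ (Fin n → ℂ)) :
    contr d (ExteriorAlgebra.ι ℂ v * x) = d v • x - ExteriorAlgebra.ι ℂ v * contr d x :=
  CliffordAlgebra.contractLeft_ι_mul d v x

theorem contr_gen_mul (d : Module.Dual ℂ (Fin n → ℂ)) (i : Fin n)
    (x : ExteriorAlgebra ℂ (Fin n → ℂ)) :
    contr d (gen i * x) = d (Pi.single i 1) • x - gen i * contr d x :=
  contr_ι_mul d _ x

theorem contr_mul_of_contr_eq_zero (d : Module.Dual ℂ (Fin n → ℂ))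
    (x y : ExteriorAlgebra ℂ (Fin n → ℂ)) (hy : contr d y = 0) :
    contr d (x * y) = contr d x * y := by
  refine CliffordAlgebra.left_induction (Q := (0 : QuadraticForm ℂ (Fin n → ℂ)))
    (P := fun x => contr d (x * y) = contr d x * y) ?_ ?_ ?_ x
  · intro r
    rw [← Algebra.smul_def, map_smul, hy, smul_zero, CliffordAlgebra.contractLeft_algebraMap,
      zero_mul]
  · intro a b ha hb
    rw [add_mul, map_add, ha, hb, map_add, add_mul]
  · intro a m ha
    have h1 := contr_ι_mul d m (a * y)
    have h2 := contr_ι_mul d m a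
    rw [mul_assoc]
    refine h1.trans ?_
    rw [ha]
    refine Eq.trans ?_ (congrArg (· * y) h2.symm)
    simp only [sub_mul, smul_mul_assoc, mul_assoc]

theorem contr_map (f : (Fin n → ℂ) →ₗ[ℂ] (Fin n → ℂ)) (d : Module.Dual ℂ (Fin n → ℂ))
    (x : ExteriorAlgebra ℂ (Fin n → ℂ)) :
    contr d (ExteriorAlgebra.map f x) = ExteriorAlgebra.map f (contr (d ∘ₗ f) x) := by
  refine CliffordAlgebra.left_induction (Q := (0 : QuadraticForm ℂ (Fin n → ℂ)))
    (P := fun x => contr d (ExteriorAlgebra.map f x) =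
      ExteriorAlgebra.map f (contr (d ∘ₗ f) x)) ?_ ?_ ?_ x
  · intro r
    rw [AlgHom.commutes, CliffordAlgebra.contractLeft_algebraMap,
      CliffordAlgebra.contractLeft_algebraMap, map_zero]
  · intro a b ha hb
    rw [map_add, map_add, ha, hb, map_add, map_add]
  · intro a m ha
    have h1 : ExteriorAlgebra.map f (ExteriorAlgebra.ι ℂ m * a) =
        ExteriorAlgebra.ι ℂ (f m) * ExteriorAlgebra.map f a := by
      rw [map_mul, ExteriorAlgebra.map_apply_ι]
    refine (congrArg (contr d) h1).trans ?_
    rw [contr_ι_mul, ha]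
    refine Eq.trans ?_ (congrArg (ExteriorAlgebra.map f) (contr_ι_mul (d ∘ₗ f) m a).symm)
    rw [map_sub, map_smul, map_mul, ExteriorAlgebra.map_apply_ι]
    rfl

theorem gen_mul_self (i : Fin n) : gen i * gen i = 0 := ExteriorAlgebra.ι_sq_zero _

theorem gen_mul_comm (i j : Fin n) : gen i * gen j = -(gen j * gen i) :=
  eq_neg_of_add_eq_zero_left (ExteriorAlgebra.ι_add_mul_swap _ _)

theorem eS_empty : eS (∅ : Finset (Fin n)) = 1 := by simp [eS]

theorem eS_insert_of_lt {m : Fin n} {S : Finset (Fin n)} (h : ∀ j ∈ S, m < j) :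
    eS (insert m S) = gen m * eS S := by
  have hm : m ∉ S := fun hm => lt_irrefl _ (h m hm)
  rw [eS, Finset.sort_insert _ (fun b hb => (h b hb).le) hm, List.map_cons, List.prod_cons, eS]

theorem gen_mul_eS_of_mem (i : Fin n) (S : Finset (Fin n)) (hi : i ∈ S) : gen i * eS S = 0 := by
  induction S using Finset.induction_on_min with
  | empty => simp at hi
  | insert m S hm ih =>
    rw [eS_insert_of_lt hm, ← mul_assoc]
    rcases Finset.mem_insert.1 hi with rfl | h
    · rw [gen_mul_self, zero_mul]
    · rw [gen_mul_comm, neg_mul, mul_assoc, ih h, mul_zero, neg_zero]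

theorem exists_gen_mul_eS (i : Fin n) (S : Finset (Fin n)) (hi : i ∉ S) :
    ∃ ε : ℂ, ε ≠ 0 ∧ gen i * eS S = ε • eS (insert i S) := by
  induction S using Finset.induction_on_min with
  | empty =>
    refine ⟨1, one_ne_zero, ?_⟩
    rw [eS_insert_of_lt (by simp), one_smul]
  | insert m S hm ih =>
    rw [Finset.mem_insert, not_or] at hi
    rcases lt_or_gt_of_ne hi.1 with h | h
    · refine ⟨1, one_ne_zero, ?_⟩
      rw [one_smul, eS_insert_of_lt (m := i)]
      intro j hj
      rcases Finset.mem_insert.1 hj with rfl | hj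
      · exact h
      · exact h.trans (hm j hj)
    · obtain ⟨ε, hε, he⟩ := ih hi.2
      refine ⟨-ε, neg_ne_zero.2 hε, ?_⟩
      have hm' : ∀ j ∈ insert i S, m < j := by
        intro j hj
        rcases Finset.mem_insert.1 hj with rfl | hj
        · exact h
        · exact hm j hj
      rw [eS_insert_of_lt hm, ← mul_assoc, gen_mul_comm, neg_mul, mul_assoc, he,
        Finset.insert_comm, eS_insert_of_lt hm', mul_smul_comm, neg_smul]

theorem exists_eS_mul_eS (S T : Finset (Fin n)) (h : Disjoint S T) :
    ∃ ε : ℂ, ε ≠ 0 ∧ eS S * eS T = ε • eS (S ∪ T) := by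
  induction S using Finset.induction_on_min with
  | empty => exact ⟨1, one_ne_zero, by simp [eS_empty]⟩
  | insert m S hm ih =>
    rw [Finset.disjoint_insert_left] at h
    obtain ⟨ε, hε, he⟩ := ih h.2
    have hm' : m ∉ S ∪ T := by
      rw [Finset.mem_union, not_or]
      exact ⟨fun hS => lt_irrefl _ (hm m hS), h.1⟩
    obtain ⟨δ, hδ, hd⟩ := exists_gen_mul_eS m (S ∪ T) hm'
    refine ⟨ε * δ, mul_ne_zero hε hδ, ?_⟩
    rw [eS_insert_of_lt hm, mul_assoc, he, mul_smul_comm, hd, smul_smul, Finset.insert_union]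

theorem contr_eS (d : Module.Dual ℂ (Fin n → ℂ)) (S : Finset (Fin n)) :
    contr d (eS S) = ∑ i ∈ S, (d (Pi.single i 1) * (-1 : ℂ) ^ (S.filter fun j => j < i).card) •
      eS (S.erase i) := by
  induction S using Finset.induction_on_min with
  | empty =>
    rw [eS_empty, Finset.sum_empty]
    exact CliffordAlgebra.contractLeft_one _ d
  | insert m S hm ih =>
    have hmS : m ∉ S := fun hS => lt_irrefl _ (hm m hS)
    have h1 : (insert m S).filter (fun j => j < m) = ∅ := by
      rw [Finset.filter_eq_empty_iff]
      intro j hj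
      rcases Finset.mem_insert.1 hj with rfl | hj
      · exact lt_irrefl _
      · exact (hm j hj).not_gt
    rw [eS_insert_of_lt hm, contr_gen_mul, ih, Finset.sum_insert hmS, Finset.erase_insert hmS, h1,
      Finset.card_empty, pow_zero, mul_one, sub_eq_add_neg, Finset.mul_sum,
      ← Finset.sum_neg_distrib]
    congr 1
    refine Finset.sum_congr rfl fun i hi => ?_
    have hmi : m < i := hm i hi
    have h2 : ((insert m S).filter fun j => j < i).card = (S.filter fun j => j < i).card + 1 := by
      rw [Finset.filter_insert, if_pos hmi, Finset.card_insert_of_notMem]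
      simp [hmS]
    have h3 : (insert m S).erase i = insert m (S.erase i) :=
      Finset.erase_insert_of_ne hmi.ne
    rw [h2, h3, eS_insert_of_lt fun j hj => hm j (Finset.mem_of_mem_erase hj), mul_smul_comm,
      ← neg_smul]
    congr 1
    ring

theorem contr_eS_eq_bdry (d : Module.Dual ℂ (Fin n → ℂ)) (S : Finset (Fin n))
    (hd : ∀ i ∈ S, d (Pi.single i 1) = 1) : contr d (eS S) = bdry S := by
  rw [contr_eS, bdry]
  exact Finset.sum_congr rfl fun i hi => by rw [hd i hi, one_mul]

theorem contr_eS_eq_zero (d : Module.Dual ℂ (Fin n → ℂ)) (S : Finset (Fin n))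
    (hd : ∀ i ∈ S, d (Pi.single i 1) = 0) : contr d (eS S) = 0 := by
  rw [contr_eS]
  exact Finset.sum_eq_zero fun i hi => by rw [hd i hi, zero_mul, zero_smul]

/-- The linear form taking the value `1` on the basis vectors indexed by `C`
and `0` on the others. -/
def indForm (C : Finset (Fin n)) : Module.Dual ℂ (Fin n → ℂ) :=
  ∑ i ∈ C, LinearMap.proj i

theorem indForm_single (C : Finset (Fin n)) (i : Fin n) :
    indForm C (Pi.single i 1) = if i ∈ C then 1 else 0 := by
  simp [indForm, Pi.single_apply]

theorem eS_ne_zero (S : Finset (Fin n)) : eS S ≠ 0 := by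
  induction S using Finset.induction_on_min with
  | empty => rw [eS_empty]; exact one_ne_zero
  | insert m S hm ih =>
    intro h
    apply ih
    have hmS : m ∉ S := fun hS => lt_irrefl _ (hm m hS)
    have h1 := contr_gen_mul (indForm {m}) m (eS S)
    rw [← eS_insert_of_lt hm, h, map_zero, contr_eS_eq_zero, mul_zero, sub_zero] at h1
    · simpa [indForm_single] using h1.symm
    · intro i hi
      rw [indForm_single, if_neg]
      rw [Finset.mem_singleton]
      rintro rfl
      exact hmS hi

theorem exists_eS_eq_gen_mul_erase {i : Fin n} {S : Finset (Fin n)} (hi : i ∈ S) :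
    ∃ ε : ℂ, eS S = ε • (gen i * eS (S.erase i)) := by
  obtain ⟨ε, hε, h⟩ := exists_gen_mul_eS i (S.erase i) (Finset.notMem_erase i S)
  refine ⟨ε⁻¹, ?_⟩
  rw [h, smul_smul, inv_mul_cancel₀ hε, one_smul, Finset.insert_erase hi]

theorem map_eS_eq_zero_of_eq_zero (f : (Fin n → ℂ) →ₗ[ℂ] (Fin n → ℂ)) {i : Fin n}
    {S : Finset (Fin n)} (hi : i ∈ S) (hf : f (Pi.single i 1) = 0) :
    ExteriorAlgebra.map f (eS S) = 0 := by
  obtain ⟨ε, h⟩ := exists_eS_eq_gen_mul_erase hi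
  rw [h, map_smul, map_mul, gen, ExteriorAlgebra.map_apply_ι, hf, map_zero, zero_mul, smul_zero]

theorem map_eS_eq_zero_of_eq (f : (Fin n → ℂ) →ₗ[ℂ] (Fin n → ℂ)) {i j : Fin n}
    {S : Finset (Fin n)} (hi : i ∈ S) (hj : j ∈ S) (hij : i ≠ j)
    (hf : f (Pi.single i 1) = f (Pi.single j 1)) :
    ExteriorAlgebra.map f (eS S) = 0 := by
  obtain ⟨ε, h⟩ := exists_eS_eq_gen_mul_erase hi
  obtain ⟨δ, h'⟩ := exists_eS_eq_gen_mul_erase (Finset.mem_erase.2 ⟨hij.symm, hj⟩)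
  rw [h, h', map_smul, map_mul, map_smul, map_mul, gen, gen, ExteriorAlgebra.map_apply_ι,
    ExteriorAlgebra.map_apply_ι, hf, mul_smul_comm, ← mul_assoc, ExteriorAlgebra.ι_sq_zero,
    zero_mul, smul_zero, smul_zero]

theorem map_eS_eq_self (f : (Fin n → ℂ) →ₗ[ℂ] (Fin n → ℂ)) (S : Finset (Fin n))
    (hf : ∀ i ∈ S, f (Pi.single i 1) = Pi.single i 1) :
    ExteriorAlgebra.map f (eS S) = eS S := by
  induction S using Finset.induction_on_min with
  | empty => rw [eS_empty, map_one]
  | insert m S hm ih =>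
    rw [eS_insert_of_lt hm, map_mul, ih fun i hi => hf i (Finset.mem_insert_of_mem hi), gen,
      ExteriorAlgebra.map_apply_ι, hf m (Finset.mem_insert_self m S)]

end Exterior

end HArr

namespace HArr

section Geometry

variable {W : Type} [AddCommGroup W] [Module ℂ W] {n : ℕ} (A : HArr W n)

theorem inter_le_amb (S : Finset (Fin n)) : A.inter S ≤ A.amb := inf_le_left

theorem inter_le_H {S : Finset (Fin n)} {i : Fin n} (hi : i ∈ S) : A.inter S ≤ A.H i :=
  inf_le_right.trans (Finset.inf_le hi)

theorem le_inter {S : Finset (Fin n)} {X : AffineSubspace ℂ W} (hX : X ≤ A.amb)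
    (h : ∀ i ∈ S, X ≤ A.H i) : X ≤ A.inter S :=
  le_inf hX (Finset.le_inf h)

theorem inter_anti {S T : Finset (Fin n)} (h : S ⊆ T) : A.inter T ≤ A.inter S :=
  inf_le_inf_left _ (Finset.inf_mono h)

theorem inter_empty : A.inter ∅ = A.amb := by simp [inter]

theorem inter_insert (i : Fin n) (S : Finset (Fin n)) :
    A.inter (insert i S) = A.inter S ⊓ A.H i := by
  rw [inter, Finset.inf_insert, inter, inf_assoc, inf_comm (A.H i)]

theorem inter_union (S T : Finset (Fin n)) :
    A.inter (S ∪ T) = A.inter S ⊓ A.inter T := by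
  rw [inter, Finset.inf_union, inter, inter, inf_inf_distrib_left]

theorem mem_sub {X : AffineSubspace ℂ W} {i : Fin n} : i ∈ A.sub X ↔ X ≤ A.H i := by
  simp [sub]

theorem inter_sub_eq {X : AffineSubspace ℂ W} (hX : A.memL X) : A.inter (A.sub X) = X := by
  obtain ⟨-, S, rfl⟩ := hX
  apply le_antisymm
  · exact A.inter_anti fun i hi => A.mem_sub.2 (A.inter_le_H hi)
  · exact A.le_inter (A.inter_le_amb S) fun i hi => A.mem_sub.1 hi

theorem memL_inter {S : Finset (Fin n)} (h : A.inter S ≠ ⊥) : A.memL (A.inter S) := ⟨h, S, rfl⟩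

theorem amb_ne_bot : A.amb ≠ ⊥ := (AffineSubspace.nonempty_iff_ne_bot _).1 A.amb_ne

theorem direction_inf_of_ne_bot {P Q : AffineSubspace ℂ W} (h : P ⊓ Q ≠ ⊥) :
    (P ⊓ Q).direction = P.direction ⊓ Q.direction := by
  obtain ⟨x, hx⟩ := (AffineSubspace.nonempty_iff_ne_bot _).2 h
  exact AffineSubspace.direction_inf_of_mem hx.1 hx.2

theorem cd_amb : A.cd A.amb = 0 := Nat.sub_self _

theorem indep_empty : A.indep ∅ := by
  refine ⟨?_, ?_⟩
  · rw [inter_empty]; exact A.amb_ne_bot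
  · rw [inter_empty, cd_amb, Finset.card_empty]

theorem ne_bot_of_le {X Y : AffineSubspace ℂ W} (hX : X ≠ ⊥) (h : X ≤ Y) : Y ≠ ⊥ :=
  ne_bot_of_le_ne_bot hX h

theorem amb_not_le_H (i : Fin n) : ¬ A.amb ≤ A.H i := by
  intro h
  have h1 := A.hyp i
  rw [le_antisymm h (A.le_amb i)] at h1
  omega

theorem inter_insert_of_le {S : Finset (Fin n)} {i : Fin n} (h : A.inter S ≤ A.H i) :
    A.inter (insert i S) = A.inter S := by
  rw [inter_insert, inf_eq_left.2 h]

theorem indep.not_dep {A : HArr W n} {S : Finset (Fin n)} (h : A.indep S) : ¬ A.dep S :=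
  fun h' => h'.2.ne h.2

theorem exists_circuit_subset {S : Finset (Fin n)} (h : A.dep S) : ∃ K ⊆ S, A.circuit K := by
  induction S using Finset.strongInduction with
  | H S ih =>
    by_cases hc : A.circuit S
    · exact ⟨S, subset_rfl, hc⟩
    · have : ∃ T ⊂ S, A.dep T := by
        by_contra hn
        push Not at hn
        exact hc ⟨h, hn⟩
      obtain ⟨T, hT, hd⟩ := this
      obtain ⟨K, hK, hK'⟩ := ih T hT hd
      exact ⟨K, hK.trans hT.1, hK'⟩

theorem nbcSet.subset {A : HArr W n} {S T : Finset (Fin n)} {σ : Equiv.Perm (Fin n)}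
    (hT : A.nbcSet σ T) (h : S ⊆ T) : A.nbcSet σ S :=
  ⟨ne_bot_of_le hT.1 (A.inter_anti h), fun U hU => hT.2 U (hU.trans h)⟩

theorem card_le_rank {S : Finset (Fin n)} (h : A.indep S) : S.card ≤ A.rank := by
  classical
  have := Finset.le_sup (f := fun S => if A.indep S then S.card else 0)
    (Finset.mem_powerset.2 (Finset.subset_univ S))
  simp only [if_pos h] at this
  exact this

theorem exists_indep_card_eq_rank : ∃ S, A.indep S ∧ S.card = A.rank := by
  classical
  obtain ⟨S, -, hS⟩ := Finset.exists_mem_eq_sup (Finset.univ : Finset (Fin n)).powerset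
    ⟨∅, Finset.empty_mem_powerset _⟩ (fun S => if A.indep S then S.card else 0)
  have hS' : A.rank = if A.indep S then S.card else 0 := hS
  by_cases h : A.indep S
  · rw [if_pos h] at hS'
    exact ⟨S, h, hS'.symm⟩
  · rw [if_neg h] at hS'
    exact ⟨∅, A.indep_empty, by rw [hS', Finset.card_empty]⟩

theorem direction_le_direction_inter {T : Finset (Fin n)} {D : Submodule ℂ W}
    (hb : A.inter T ≠ ⊥) (hD : D ≤ A.amb.direction) (h : ∀ i ∈ T, D ≤ (A.H i).direction) :
    D ≤ (A.inter T).direction := by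
  induction T using Finset.induction_on with
  | empty => rwa [inter_empty]
  | insert i T hi ih =>
    rw [inter_insert] at hb ⊢
    rw [direction_inf_of_ne_bot hb]
    exact le_inf (ih (ne_bot_of_le hb inf_le_left) fun j hj => h j (Finset.mem_insert_of_mem hj))
      (h i (Finset.mem_insert_self i T))

theorem direction_sup_le_amb (S T : Finset (Fin n)) :
    (A.inter S).direction ⊔ (A.inter T).direction ≤ A.amb.direction :=
  sup_le (AffineSubspace.direction_le (A.inter_le_amb S))
    (AffineSubspace.direction_le (A.inter_le_amb T))

theorem isBase_of_card_eq_rank {B : Finset (Fin n)} (hB : A.indep B) (h : B.card = A.rank) :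
    A.isBase B :=
  ⟨hB, fun _ hT hBT => Finset.eq_of_subset_of_card_le hBT (h ▸ A.card_le_rank hT)⟩

variable [FiniteDimensional ℂ W]

theorem cd_add_finrank {X : AffineSubspace ℂ W} (h : X ≤ A.amb) :
    A.cd X + finrank ℂ X.direction = finrank ℂ A.amb.direction :=
  Nat.sub_add_cancel (Submodule.finrank_mono (AffineSubspace.direction_le h))

theorem eq_of_le_of_cd_le {X Y : AffineSubspace ℂ W} (hX : X ≠ ⊥) (h : X ≤ Y) (hY : Y ≤ A.amb)
    (hc : A.cd X ≤ A.cd Y) : X = Y := by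
  have h1 := A.cd_add_finrank hY
  have h2 := A.cd_add_finrank (h.trans hY)
  refine AffineSubspace.eq_of_direction_eq_of_nonempty_of_le
    (Submodule.eq_of_le_of_finrank_le (AffineSubspace.direction_le h) (by omega))
    ((AffineSubspace.nonempty_iff_ne_bot _).2 hX) h

theorem direction_sup_eq {D : Submodule ℂ W} {i : Fin n} (hD : D ≤ A.amb.direction)
    (h : ¬ D ≤ (A.H i).direction) : D ⊔ (A.H i).direction = A.amb.direction := by
  have hle : D ⊔ (A.H i).direction ≤ A.amb.direction :=
    sup_le hD (AffineSubspace.direction_le (A.le_amb i))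
  refine Submodule.eq_of_le_of_finrank_le hle ?_
  have hlt : (A.H i).direction < D ⊔ (A.H i).direction := by
    refine lt_of_le_of_ne le_sup_right fun he => h ?_
    rw [he]
    exact le_sup_left
  have h1 := Submodule.finrank_lt_finrank_of_lt hlt
  have h2 := A.hyp i
  omega

theorem cd_inf_H {X : AffineSubspace ℂ W} {i : Fin n} (hX : X ≤ A.amb) (hb : X ⊓ A.H i ≠ ⊥)
    (h : ¬ X ≤ A.H i) : A.cd (X ⊓ A.H i) = A.cd X + 1 := by
  have hd := direction_inf_of_ne_bot hb
  have hn : ¬ X.direction ≤ (A.H i).direction := by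
    intro hle
    rw [inf_eq_left.2 hle] at hd
    exact h (inf_eq_left.1 (AffineSubspace.eq_of_direction_eq_of_nonempty_of_le hd
      ((AffineSubspace.nonempty_iff_ne_bot _).2 hb) inf_le_left))
  have h1 := Submodule.finrank_sup_add_finrank_inf_eq X.direction (A.H i).direction
  rw [A.direction_sup_eq (AffineSubspace.direction_le hX) hn, ← hd] at h1
  have h2 := A.hyp i
  have h3 := A.cd_add_finrank hX
  have h4 := A.cd_add_finrank (inf_le_left.trans hX : X ⊓ A.H i ≤ A.amb)
  omega

theorem cd_inter_insert_of_not_le {S : Finset (Fin n)} {i : Fin n}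
    (hb : A.inter (insert i S) ≠ ⊥) (h : ¬ A.inter S ≤ A.H i) :
    A.cd (A.inter (insert i S)) = A.cd (A.inter S) + 1 := by
  rw [inter_insert] at hb ⊢
  exact A.cd_inf_H (A.inter_le_amb S) hb h

theorem cd_inter_insert_le {S : Finset (Fin n)} {i : Fin n} (hb : A.inter (insert i S) ≠ ⊥) :
    A.cd (A.inter (insert i S)) ≤ A.cd (A.inter S) + 1 := by
  by_cases h : A.inter S ≤ A.H i
  · rw [A.inter_insert_of_le h]; omega
  · exact (A.cd_inter_insert_of_not_le hb h).le

theorem cd_inter_union_le_add_card (S U : Finset (Fin n)) (hb : A.inter (S ∪ U) ≠ ⊥) :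
    A.cd (A.inter (S ∪ U)) ≤ A.cd (A.inter S) + U.card := by
  induction U using Finset.induction_on with
  | empty => simp
  | insert i U hi ih =>
    rw [Finset.union_insert] at hb ⊢
    have h1 := A.cd_inter_insert_le hb
    have h2 := ih (ne_bot_of_le hb (A.inter_anti (Finset.subset_insert _ _)))
    rw [Finset.card_insert_of_notMem hi]
    omega

theorem cd_inter_le_card {S : Finset (Fin n)} (hb : A.inter S ≠ ⊥) :
    A.cd (A.inter S) ≤ S.card := by
  have h := A.cd_inter_union_le_add_card ∅ S (by rwa [Finset.empty_union])
  rwa [Finset.empty_union, inter_empty, cd_amb, zero_add] at h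

theorem indep_or_dep {S : Finset (Fin n)} (hb : A.inter S ≠ ⊥) : A.indep S ∨ A.dep S := by
  rcases (A.cd_inter_le_card hb).eq_or_lt with h | h
  · exact Or.inl ⟨hb, h⟩
  · exact Or.inr ⟨hb, h⟩

theorem indep_insert {S : Finset (Fin n)} {i : Fin n} (hS : A.indep S)
    (hb : A.inter (insert i S) ≠ ⊥) (h : ¬ A.inter S ≤ A.H i) : A.indep (insert i S) := by
  refine ⟨hb, ?_⟩
  rw [A.cd_inter_insert_of_not_le hb h, hS.2, Finset.card_insert_of_notMem]
  exact fun hi => h (A.inter_le_H hi)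

theorem dep_insert {S : Finset (Fin n)} {i : Fin n} (hb : A.inter S ≠ ⊥) (hi : i ∉ S)
    (h : A.inter S ≤ A.H i) : A.dep (insert i S) := by
  rw [dep, A.inter_insert_of_le h, Finset.card_insert_of_notMem hi]
  exact ⟨hb, Nat.lt_succ_of_le (A.cd_inter_le_card hb)⟩

theorem indep.subset {A : HArr W n} {S T : Finset (Fin n)} (hT : A.indep T) (h : S ⊆ T) :
    A.indep S := by
  have hb := ne_bot_of_le hT.1 (A.inter_anti h)
  refine ⟨hb, le_antisymm (A.cd_inter_le_card hb) ?_⟩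
  have h1 := A.cd_inter_union_le_add_card S (T \ S)
  rw [Finset.union_sdiff_of_subset h] at h1
  have h2 := h1 hT.1
  rw [hT.2, Finset.card_sdiff_of_subset h] at h2
  have := Finset.card_le_card h
  omega

theorem indep.not_le_H {A : HArr W n} {S : Finset (Fin n)} {i : Fin n}
    (h : A.indep (insert i S)) (hi : i ∉ S) : ¬ A.inter S ≤ A.H i := fun hle =>
  h.not_dep (A.dep_insert (h.subset (Finset.subset_insert i S)).1 hi hle)

/-- An independent nbc set `S` contains the least hyperplane through `⋂ S`. -/
theorem nbcSet.not_forall_lt {A : HArr W n} {S : Finset (Fin n)} {j : Fin n}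
    (hS : A.nbcSet 1 S) (hi : A.indep S) (hj : A.inter S ≤ A.H j) : ¬ ∀ i ∈ S, j < i := by
  intro hlt
  have hjS : j ∉ S := fun h => lt_irrefl _ (hlt j h)
  obtain ⟨K, hK, hc⟩ := A.exists_circuit_subset (A.dep_insert hi.1 hjS hj)
  have hjK : j ∈ K := by
    by_contra hjK
    exact (hi.subset ((Finset.subset_insert_iff_of_notMem hjK).1 hK)).not_dep hc.1
  have hKS : K.erase j ⊆ S := Finset.subset_insert_iff.1 hK
  refine hS.2 (K.erase j) hKS ⟨j, Finset.notMem_erase j K, fun i hi => hlt i (hKS hi), ?_⟩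
  rwa [Finset.insert_erase hjK]

theorem inf_H_ne_bot {X : AffineSubspace ℂ W} {i : Fin n} (hX : X ≤ A.amb) (hb : X ≠ ⊥)
    (h : ¬ X.direction ≤ (A.H i).direction) : X ⊓ A.H i ≠ ⊥ := by
  obtain ⟨x, hx⟩ := (AffineSubspace.nonempty_iff_ne_bot _).2 hb
  obtain ⟨y, hy⟩ := A.nonemptyH i
  have hxy : y -ᵥ x ∈ A.amb.direction :=
    AffineSubspace.vsub_mem_direction (A.le_amb i hy) (hX hx)
  rw [← A.direction_sup_eq (AffineSubspace.direction_le hX) h] at hxy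
  obtain ⟨u, hu, v, hv, huv⟩ := Submodule.mem_sup.1 hxy
  rw [← AffineSubspace.nonempty_iff_ne_bot]
  refine ⟨u +ᵥ x, AffineSubspace.vadd_mem_of_mem_direction hu hx, ?_⟩
  have he : u +ᵥ x = -v +ᵥ y := by
    simp only [vadd_eq_add, vsub_eq_sub] at huv ⊢
    rw [eq_sub_iff_add_eq] at huv
    rw [← huv]
    abel
  rw [he]
  exact AffineSubspace.vadd_mem_of_mem_direction (Submodule.neg_mem _ hv) hy

theorem isBase.card_eq_rank {A : HArr W n} {B : Finset (Fin n)} (hB : A.isBase B) :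
    B.card = A.rank := by
  refine le_antisymm (A.card_le_rank hB.1) ?_
  obtain ⟨T, hT, hr⟩ := A.exists_indep_card_eq_rank
  rw [← hr]
  by_contra! hlt
  have hex : ∃ i ∈ T, ¬ (A.inter B).direction ≤ (A.H i).direction := by
    by_contra! hn
    have h1 := Submodule.finrank_mono (A.direction_le_direction_inter hT.1
      (AffineSubspace.direction_le (A.inter_le_amb B)) hn)
    have h2 := A.cd_add_finrank (A.inter_le_amb B)
    have h3 := A.cd_add_finrank (A.inter_le_amb T)
    rw [hB.1.2] at h2
    rw [hT.2] at h3
    omega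
  obtain ⟨i, -, hi⟩ := hex
  have hle : ¬ A.inter B ≤ A.H i := fun h => hi (AffineSubspace.direction_le h)
  have hb := A.inf_H_ne_bot (A.inter_le_amb B) hB.1.1 hi
  rw [← inter_insert] at hb
  have h1 := hB.2 _ (A.indep_insert hB.1 hb hle) (Finset.subset_insert i B)
  exact hle (A.inter_le_H (h1 ▸ Finset.mem_insert_self i B))

theorem cd_inter_union_add {S T : Finset (Fin n)} (hb : A.inter (S ∪ T) ≠ ⊥) :
    A.cd (A.inter (S ∪ T)) + finrank ℂ A.amb.direction =
      A.cd (A.inter S) + A.cd (A.inter T) +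
        finrank ℂ ↥((A.inter S).direction ⊔ (A.inter T).direction) := by
  have h1 := Submodule.finrank_sup_add_finrank_inf_eq (A.inter S).direction (A.inter T).direction
  have h2 := A.cd_add_finrank (A.inter_le_amb S)
  have h3 := A.cd_add_finrank (A.inter_le_amb T)
  have h4 := A.cd_add_finrank (A.inter_le_amb (S ∪ T))
  rw [inter_union] at hb h4 ⊢
  rw [← direction_inf_of_ne_bot hb] at h1
  omega

theorem cd_inter_union_le {S T : Finset (Fin n)} (hb : A.inter (S ∪ T) ≠ ⊥) :
    A.cd (A.inter (S ∪ T)) ≤ A.cd (A.inter S) + A.cd (A.inter T) := by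
  have h1 := A.cd_inter_union_add hb
  have h2 := Submodule.finrank_mono (A.direction_sup_le_amb S T)
  omega

/-- The complement of a direct factor `C` of `𝒜_X` is independent of it: the directions of
the two intersections span the ambient direction. -/
theorem direction_sup_eq_amb {S T : Finset (Fin n)} (hb : A.inter (S ∪ T) ≠ ⊥)
    (h : A.cd (A.inter S) + A.cd (A.inter T) = A.cd (A.inter (S ∪ T))) :
    (A.inter S).direction ⊔ (A.inter T).direction = A.amb.direction := by
  have h1 := A.cd_inter_union_add hb
  exact Submodule.eq_of_le_of_finrank_le (A.direction_sup_le_amb S T) (by omega)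

/-- If `𝒜_X` splits as `C ⊔ C'`, a dependent subset of `𝒜_X` is dependent in one of the factors. -/
theorem dep_of_dep_union {C C' S T : Finset (Fin n)} (hb : A.inter (C ∪ C') ≠ ⊥)
    (h : A.cd (A.inter C) + A.cd (A.inter C') = A.cd (A.inter (C ∪ C')))
    (hS : S ⊆ C) (hT : T ⊆ C') (hd : A.dep (S ∪ T)) : A.dep S ∨ A.dep T := by
  by_contra! hn
  have hS' := (A.indep_or_dep (ne_bot_of_le hd.1
    (A.inter_anti Finset.subset_union_left))).resolve_right hn.1
  have hT' := (A.indep_or_dep (ne_bot_of_le hd.1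
    (A.inter_anti Finset.subset_union_right))).resolve_right hn.2
  have h1 : A.amb.direction ≤ (A.inter S).direction ⊔ (A.inter T).direction := by
    rw [← A.direction_sup_eq_amb hb h]
    exact sup_le_sup (AffineSubspace.direction_le (A.inter_anti hS))
      (AffineSubspace.direction_le (A.inter_anti hT))
  have h2 := A.cd_inter_union_add hd.1
  have h3 := Submodule.finrank_mono h1
  have h4 := hd.2
  have h5 := Finset.card_union_le S T
  rw [hS'.2, hT'.2] at h2
  omega

/-- Every `𝒜_X`, `X ≠ V`, has a direct factor `𝒜_Y` with `Y` dense. -/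
theorem exists_dense_factor {X : AffineSubspace ℂ W} (hX : A.memL X) (hne : X ≠ A.amb) :
    ∃ Y, A.memL Y ∧ Y ≠ A.amb ∧ A.denseL Y ∧ A.sub Y ⊆ A.sub X ∧
      A.cd (A.inter (A.sub Y)) + A.cd (A.inter (A.sub X \ A.sub Y)) = A.cd X := by
  have hXe := A.inter_sub_eq hX
  set P : Finset (Fin n) → Prop := fun C => C ⊆ A.sub X ∧ C.Nonempty ∧
    A.cd (A.inter C) + A.cd (A.inter (A.sub X \ C)) = A.cd X with hP
  have hPX : P (A.sub X) := by
    refine ⟨subset_rfl, ?_, ?_⟩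
    · rw [Finset.nonempty_iff_ne_empty]
      intro h
      rw [h, inter_empty] at hXe
      exact hne hXe.symm
    · rw [Finset.sdiff_self, inter_empty, cd_amb, hXe, add_zero]
  have hmin : ∃ C, P C ∧ ∀ C' ⊂ C, ¬ P C' := by
    by_contra! hn
    have : ∀ C, ¬ P C := by
      intro C
      induction C using Finset.strongInduction with
      | H C ih =>
        intro hC
        obtain ⟨C', hC', hPC'⟩ := hn C hC
        exact ih C' hC' hPC'
    exact this _ hPX
  obtain ⟨C, ⟨hCX, hCne, hCc⟩, hCmin⟩ := hmin
  have hun : C ∪ (A.sub X \ C) = A.sub X := Finset.union_sdiff_of_subset hCX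
  have hXb : A.inter (A.sub X) ≠ ⊥ := hXe.symm ▸ hX.1
  have hCb : A.inter C ≠ ⊥ := ne_bot_of_le hXb (A.inter_anti hCX)
  have hXC : X ≤ A.inter C := hXe ▸ A.inter_anti hCX
  have hsub : A.sub (A.inter C) = C := by
    apply subset_antisymm
    · intro i hi
      rw [mem_sub] at hi
      by_contra hiC
      have hiX : i ∈ A.sub X \ C := Finset.mem_sdiff.2 ⟨A.mem_sub.2 (hXC.trans hi), hiC⟩
      have h1 := A.direction_sup_eq_amb (S := C) (T := A.sub X \ C) (by rwa [hun])
        (by rwa [hun, hXe])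
      have h2 : A.amb.direction ≤ (A.H i).direction := h1 ▸
        sup_le (AffineSubspace.direction_le hi) (AffineSubspace.direction_le (A.inter_le_H hiX))
      have h3 := Submodule.finrank_mono h2
      have h4 := A.hyp i
      omega
    · exact fun i hi => A.mem_sub.2 (A.inter_le_H hi)
  refine ⟨A.inter C, A.memL_inter hCb, ?_, ?_, by rwa [hsub], by rwa [hsub]⟩
  · obtain ⟨i, hi⟩ := hCne
    intro h
    exact A.amb_not_le_H i (h ▸ A.inter_le_H hi)
  · rintro ⟨S, T, hdis, hS, hT, hST, hcd⟩
    rw [hsub] at hST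
    have hSC : S ⊆ C := hST ▸ Finset.subset_union_left
    have hdiff : A.sub X \ S = T ∪ (A.sub X \ C) := by
      ext i
      have h1 : i ∈ C ↔ i ∈ S ∨ i ∈ T := by rw [← hST, Finset.mem_union]
      have h2 := @hCX i
      have h3 : i ∈ S → i ∉ T := fun h => Finset.disjoint_left.1 hdis h
      simp only [Finset.mem_sdiff, Finset.mem_union]
      tauto
    refine hCmin S ?_ ⟨hSC.trans hCX, hS, ?_⟩
    · refine Finset.ssubset_iff_subset_ne.2 ⟨hSC, ?_⟩
      rintro rfl
      obtain ⟨t, ht⟩ := hT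
      exact Finset.disjoint_left.1 hdis (hST ▸ Finset.mem_union_right _ ht) ht
    · have hSX : S ∪ (A.sub X \ S) = A.sub X := Finset.union_sdiff_of_subset (hSC.trans hCX)
      have h1 := A.cd_inter_union_le (S := S) (T := A.sub X \ S) (by rwa [hSX])
      have h2 := A.cd_inter_union_le (S := T) (T := A.sub X \ C) (by
        rw [← hdiff]
        exact ne_bot_of_le hXb (A.inter_anti Finset.sdiff_subset))
      rw [hSX, hXe] at h1
      rw [← hdiff] at h2
      omega

end Geometry

end HArr

namespace HArr

section Independence

variable {W : Type} [AddCommGroup W] [Module ℂ W] {n : ℕ} (A : HArr W n)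

theorem omB_eq_zero_of_inter_eq_bot {S : Finset (Fin n)} (h : A.inter S = ⊥) : A.omB S = 0 := by
  rw [omB, osMk, RingQuot.mkAlgHom_rel ℂ (OSRel.isBot S h), map_zero]

theorem osMk_bdry_eq_zero {S : Finset (Fin n)} (h : A.dep S) : A.osMk (bdry S) = 0 := by
  rw [osMk, RingQuot.mkAlgHom_rel ℂ (OSRel.isDep S h), map_zero]

theorem omB_eq_zero_of_dep {S : Finset (Fin n)} (h : A.dep S) : A.omB S = 0 := by
  have hne : S.Nonempty := by
    rw [Finset.nonempty_iff_ne_empty]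
    rintro rfl
    simpa using h.2
  obtain ⟨t, ht⟩ := hne
  have h1 := contr_gen_mul (indForm S) t (eS S)
  rw [gen_mul_eS_of_mem t S ht, map_zero, indForm_single, if_pos ht, one_smul,
    contr_eS_eq_bdry _ _ fun i hi => by rw [indForm_single, if_pos hi]] at h1
  rw [omB, sub_eq_zero.1 h1.symm, map_mul, A.osMk_bdry_eq_zero h, mul_zero]

/-- `A.IsStep B i b` says that in the descending flag of the ordered set `B`, the hyperplane
`H i` contains the intersection of `{b' ∈ B | b ≤ b'}` but not that of `{b' ∈ B | b < b'}`. -/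
def IsStep (B : Finset (Fin n)) (i b : Fin n) : Prop :=
  b ∈ B ∧ A.inter (B.filter (b ≤ ·)) ≤ A.H i ∧ ¬ A.inter (B.filter (b < ·)) ≤ A.H i

theorem IsStep.le {A : HArr W n} {B : Finset (Fin n)} {i b c : Fin n} (hb : A.IsStep B i b)
    (hc : A.IsStep B i c) : b ≤ c := by
  by_contra! h
  refine hc.2.2 (le_trans (A.inter_anti ?_) hb.2.1)
  exact Finset.monotone_filter_right B fun x _ hx => lt_of_lt_of_le h hx

theorem exists_isStep {B : Finset (Fin n)} {i : Fin n} (h : A.inter B ≤ A.H i) :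
    ∃ b, A.IsStep B i b := by
  induction B using Finset.induction_on_min with
  | empty => exact absurd (A.inter_empty ▸ h) (A.amb_not_le_H i)
  | insert m B hm ih =>
    have hlt : ∀ b, m ≤ b → (insert m B).filter (b < ·) = B.filter (b < ·) := by
      intro b hb
      rw [Finset.filter_insert, if_neg hb.not_gt]
    by_cases hB : A.inter B ≤ A.H i
    · obtain ⟨b, hb, h1, h2⟩ := ih hB
      refine ⟨b, Finset.mem_insert_of_mem hb, ?_, ?_⟩
      · rwa [Finset.filter_insert, if_neg (hm b hb).not_ge]
      · rwa [hlt b (hm b hb).le]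
    · refine ⟨m, Finset.mem_insert_self m B, ?_, ?_⟩
      · rwa [Finset.filter_true_of_mem]
        intro x hx
        rcases Finset.mem_insert.1 hx with rfl | hx
        · exact le_rfl
        · exact (hm x hx).le
      · rwa [hlt m le_rfl, Finset.filter_true_of_mem hm]

/-- The linear map collapsing each step of the flag of `B` onto one basis vector (given by `ρ`)
and killing the hyperplanes not containing `⋂ B`. -/
def collapse (B : Finset (Fin n)) (ρ : Fin n → Fin n) : (Fin n → ℂ) →ₗ[ℂ] (Fin n → ℂ) :=
  (Pi.basisFun ℂ (Fin n)).constr ℂ fun i => if i ∈ A.sub (A.inter B) then Pi.single (ρ i) 1 else 0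

theorem collapse_single (B : Finset (Fin n)) (ρ : Fin n → Fin n) (i : Fin n) :
    A.collapse B ρ (Pi.single i 1) =
      if i ∈ A.sub (A.inter B) then Pi.single (ρ i) 1 else 0 := by
  have h := (Pi.basisFun ℂ (Fin n)).constr_basis ℂ
    (fun i => if i ∈ A.sub (A.inter B) then (Pi.single (ρ i) 1 : Fin n → ℂ) else 0) i
  rwa [Pi.basisFun_apply] at h

theorem map_collapse_eS_eq_zero {B T : Finset (Fin n)} {ρ : Fin n → Fin n}
    (h : ¬ (T ⊆ A.sub (A.inter B) ∧ Set.InjOn ρ T)) :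
    ExteriorAlgebra.map (A.collapse B ρ) (eS T) = 0 := by
  by_cases h1 : T ⊆ A.sub (A.inter B)
  · have h2 : ¬ Set.InjOn ρ T := fun h2 => h ⟨h1, h2⟩
    simp only [Set.InjOn, not_forall] at h2
    obtain ⟨i, hi, j, hj, hρ, hij⟩ := h2
    refine map_eS_eq_zero_of_eq _ hi hj hij ?_
    rw [collapse_single, collapse_single, if_pos (h1 hi), if_pos (h1 hj), hρ]
  · obtain ⟨i, hi, hi'⟩ := Finset.not_subset.1 h1
    refine map_eS_eq_zero_of_eq_zero _ hi ?_
    rw [collapse_single, if_neg hi']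

variable [FiniteDimensional ℂ W]

theorem isStep_self {B : Finset (Fin n)} (hB : A.indep B) {b : Fin n} (hb : b ∈ B) :
    A.IsStep B b b := by
  refine ⟨hb, A.inter_le_H (Finset.mem_filter.2 ⟨hb, le_rfl⟩), ?_⟩
  refine indep.not_le_H (hB.subset (Finset.insert_subset hb (Finset.filter_subset _ _))) ?_
  simp

/-- A transversal of the steps of the flag of `B` is independent. -/
theorem indep_of_isStep {B T : Finset (Fin n)} (hB : A.inter B ≠ ⊥) (ρ : Fin n → Fin n)
    (hρ : ∀ i ∈ T, A.IsStep B i (ρ i)) (hinj : Set.InjOn ρ T) : A.indep T := by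
  induction T using Finset.induction_on_min_value ρ with
  | empty => exact A.indep_empty
  | insert a T ha hle ih =>
    have hTa : ∀ x ∈ T, x ∈ insert a T := fun x hx => Finset.mem_insert_of_mem hx
    have haT : a ∈ insert a T := Finset.mem_insert_self a T
    have hT := ih (fun i hi => hρ i (hTa i hi)) (hinj.mono (by simp))
    refine A.indep_insert hT ?_ fun h => (hρ a haT).2.2 (le_trans ?_ h)
    · refine ne_bot_of_le hB (A.le_inter (A.inter_le_amb B) fun i hi => ?_)
      exact (A.inter_anti (Finset.filter_subset _ _)).trans (hρ i hi).2.1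
    · refine A.le_inter (A.inter_le_amb _) fun x hx => ?_
      refine le_trans (A.inter_anti ?_) (hρ x (hTa x hx)).2.1
      have hlt : ρ a < ρ x := by
        refine lt_of_le_of_ne (hle x hx) fun he => ha ?_
        rwa [hinj (Finset.mem_coe.2 haT) (Finset.mem_coe.2 (hTa x hx)) he]
      exact Finset.monotone_filter_right B fun y _ hy => lt_of_lt_of_le hlt hy

theorem map_collapse_rel {B : Finset (Fin n)} (hB : A.inter B ≠ ⊥) {ρ : Fin n → Fin n}
    (hρ : ∀ i ∈ A.sub (A.inter B), A.IsStep B i (ρ i))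
    {x y : ExteriorAlgebra ℂ (Fin n → ℂ)} (h : OSRel A x y) :
    ExteriorAlgebra.map (A.collapse B ρ) x = ExteriorAlgebra.map (A.collapse B ρ) y := by
  have key : ∀ T, T ⊆ A.sub (A.inter B) ∧ Set.InjOn ρ T → A.indep T := fun T hT =>
    A.indep_of_isStep hB ρ (fun i hi => hρ i (hT.1 hi)) hT.2
  rw [show y = 0 by cases h <;> rfl, map_zero]
  cases h with
  | isBot S hS => exact A.map_collapse_eS_eq_zero fun hn => (key S hn).1 hS
  | isDep S hS =>
    by_cases hsub : S ⊆ A.sub (A.inter B)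
    · rw [← contr_eS_eq_bdry (indForm Finset.univ ∘ₗ A.collapse B ρ), ← contr_map,
        A.map_collapse_eS_eq_zero fun hn => (key S hn).not_dep hS, map_zero]
      intro i hi
      rw [LinearMap.comp_apply, collapse_single, if_pos (hsub hi), indForm_single,
        if_pos (Finset.mem_univ _)]
    · obtain ⟨s, hs, hs'⟩ := Finset.not_subset.1 hsub
      rw [bdry, map_sum]
      refine Finset.sum_eq_zero fun i hi => ?_
      rw [map_smul, A.map_collapse_eS_eq_zero, smul_zero]
      intro hn
      by_cases his : s = i
      · subst his
        have hind := key _ hn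
        have hle : A.inter (S.erase s) ≤ A.H s := by
          by_contra hle
          have := A.indep_insert hind (by rw [Finset.insert_erase hs]; exact hS.1) hle
          rw [Finset.insert_erase hs] at this
          exact this.not_dep hS
        exact hs' (A.mem_sub.2 ((A.le_inter (A.inter_le_amb B)
          fun j hj => A.mem_sub.1 (hn.1 hj)).trans hle))
      · exact hs' (hn.1 (Finset.mem_erase.2 ⟨his, hs⟩))

/-- Residues along the flag of an nbc set `B`: a linear map on the Orlik–Solomon algebra that does
not kill `ω_B` but kills every `ω_T` with `|T| = |B|`, `T ≠ B` whose index sum is at most that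
of `B`. -/
theorem exists_residue {B : Finset (Fin n)} (hn : A.nbcSet 1 B) (hi : A.indep B) :
    ∃ f : OS A →ₗ[ℂ] ExteriorAlgebra ℂ (Fin n → ℂ), f (A.omB B) ≠ 0 ∧
      ∀ T : Finset (Fin n), T.card = B.card → T ≠ B →
        ∑ i ∈ T, (i : ℕ) ≤ ∑ i ∈ B, (i : ℕ) → f (A.omB T) = 0 := by
  have hex : ∀ i, ∃ b, i ∈ A.sub (A.inter B) → A.IsStep B i b := by
    intro i
    by_cases h : i ∈ A.sub (A.inter B)
    · obtain ⟨b, hb⟩ := A.exists_isStep (A.mem_sub.1 h)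
      exact ⟨b, fun _ => hb⟩
    · exact ⟨i, fun h' => absurd h' h⟩
  choose ρ hρ using hex
  let φ : OS A →ₐ[ℂ] ExteriorAlgebra ℂ (Fin n → ℂ) :=
    RingQuot.liftAlgHom ℂ ⟨ExteriorAlgebra.map (A.collapse B ρ),
      fun _ _ h => A.map_collapse_rel hi.1 hρ h⟩
  have hφ : ∀ T, φ (A.omB T) = ExteriorAlgebra.map (A.collapse B ρ) (eS T) := fun T =>
    RingQuot.liftAlgHom_mkAlgHom_apply ℂ _ _ _
  refine ⟨φ.toLinearMap, ?_, ?_⟩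
  · rw [AlgHom.toLinearMap_apply, hφ, map_eS_eq_self]
    · exact eS_ne_zero B
    · intro b hb
      have hbX : b ∈ A.sub (A.inter B) := A.mem_sub.2 (A.inter_le_H hb)
      have h1 := A.isStep_self hi hb
      rw [collapse_single, if_pos hbX, le_antisymm ((hρ b hbX).le h1) (h1.le (hρ b hbX))]
  · intro T hc hne hle
    rw [AlgHom.toLinearMap_apply, hφ]
    refine A.map_collapse_eS_eq_zero fun hT => hne ?_
    have himg : T.image ρ = B := by
      refine Finset.eq_of_subset_of_card_le ?_ ?_
      · exact Finset.image_subset_iff.2 fun i hi => (hρ i (hT.1 hi)).1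
      · rw [Finset.card_image_of_injOn hT.2, hc]
    have hρle : ∀ i ∈ T, ρ i ≤ i := by
      intro i hiT
      by_contra! hlt
      refine (hn.subset (Finset.filter_subset (ρ i ≤ ·) B)).not_forall_lt
        (hi.subset (Finset.filter_subset _ B)) (hρ i (hT.1 hiT)).2.1 fun j hj => ?_
      exact hlt.trans_le (Finset.mem_filter.1 hj).2
    have hsum : ∑ i ∈ B, (i : ℕ) = ∑ i ∈ T, (ρ i : ℕ) := by
      rw [← himg, Finset.sum_image hT.2]
    have heq : ∀ i ∈ T, (ρ i : ℕ) = i :=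
      (Finset.sum_eq_sum_iff_of_le fun i hi => Fin.le_def.1 (hρle i hi)).1
        (le_antisymm (Finset.sum_le_sum fun i hi => Fin.le_def.1 (hρle i hi)) (hsum ▸ hle))
    rw [← himg]
    symm
    exact (Finset.image_congr fun i hi => Fin.ext (heq i hi)).trans Finset.image_id

theorem linearIndependent_omB_nbcBase :
    LinearIndependent ℂ fun B : {S : Finset (Fin n) // A.nbcBase 1 S} => A.omB B.1 := by
  classical
  rw [linearIndependent_iff']
  intro s g hg
  by_contra! hne
  have hne' : (s.filter fun B => g B ≠ 0).Nonempty := by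
    obtain ⟨B, hB, hgB⟩ := hne
    exact ⟨B, Finset.mem_filter.2 ⟨hB, hgB⟩⟩
  obtain ⟨B, hB, hmax⟩ :=
    Finset.exists_max_image _ (fun B => ∑ i ∈ B.1, ((i : Fin n) : ℕ)) hne'
  rw [Finset.mem_filter] at hB
  obtain ⟨f, hf, hf'⟩ := A.exists_residue B.2.1 B.2.2.1
  have h1 := congrArg f hg
  rw [map_sum, map_zero, Finset.sum_eq_single_of_mem B hB.1, map_smul] at h1
  · exact (smul_ne_zero hB.2 hf) h1
  · intro T hT hTB
    rw [map_smul]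
    by_cases hgT : g T = 0
    · rw [hgT, zero_smul]
    · rw [hf' T.1 (by rw [T.2.2.card_eq_rank, B.2.2.card_eq_rank])
        (fun h => hTB (Subtype.ext h)) (hmax T (Finset.mem_filter.2 ⟨hT, hgT⟩)), smul_zero]

end Independence

end HArr

namespace HArr

section Spanning

variable {W : Type} [AddCommGroup W] [Module ℂ W] {n : ℕ} (A : HArr W n) (lam : Fin n → ℂ)

theorem Xi_eq_prod_sort (S : Finset (Fin n)) :
    A.Xi 1 lam S =
      ((S.sort (· ≤ ·)).map fun i => A.omLamX lam (A.inter (S.filter (i ≤ ·)))).prod := by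
  have htup : ∀ p : Fin S.card, tup 1 S p = S.orderEmbOfFin rfl p := by
    intro p
    have h : ∀ (S' : Finset (Fin n)) (h' : S'.card = S.card), S' = S →
        ((S'.orderIsoOfFin h' p).1 : Fin n) = S.orderEmbOfFin rfl p := by
      rintro S' h' rfl
      rw [Finset.coe_orderIsoOfFin_apply]
    exact h _ (Finset.card_image_of_injective S (Equiv.injective (1 : Equiv.Perm (Fin n))))
      Finset.image_id
  have hlist : S.sort (· ≤ ·) = (List.finRange S.card).map (S.orderEmbOfFin rfl) := by
    apply List.ext_getElem
    · simp
    · intro i h1 h2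
      simp
  rw [hlist, List.map_map, Xi]
  congr 1
  refine List.map_congr_left fun p _ => ?_
  rw [flag, htup]
  rfl

theorem Xi_empty : A.Xi 1 lam ∅ = 1 := by simp [Xi_eq_prod_sort]

theorem Xi_insert_of_lt {m : Fin n} {S : Finset (Fin n)} (h : ∀ j ∈ S, m < j) :
    A.Xi 1 lam (insert m S) = A.omLamX lam (A.inter (insert m S)) * A.Xi 1 lam S := by
  have hm : m ∉ S := fun hm => lt_irrefl _ (h m hm)
  rw [Xi_eq_prod_sort, Xi_eq_prod_sort, Finset.sort_insert _ (fun b hb => (h b hb).le) hm,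
    List.map_cons, List.prod_cons, Finset.filter_true_of_mem]
  · congr 2
    refine List.map_congr_left fun i hi => ?_
    rw [Finset.filter_insert, if_neg (h i ((Finset.mem_sort _).1 hi)).not_ge]
  · intro j hj
    rcases Finset.mem_insert.1 hj with rfl | hj
    · exact le_rfl
    · exact (h j hj).le

theorem omB_empty : A.omB ∅ = 1 := by rw [omB, eS_empty, map_one]

theorem omLamX_mul_self (X : AffineSubspace ℂ W) : A.omLamX lam X * A.omLamX lam X = 0 := by
  have h : A.omLamX lam X =
      A.osMk (ExteriorAlgebra.ι ℂ (∑ i ∈ A.sub X, lam i • Pi.single i 1)) := by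
    rw [omLamX, map_sum, map_sum]
    refine Finset.sum_congr rfl fun i _ => ?_
    rw [map_smul, map_smul]
    rfl
  rw [h, ← map_mul, ExteriorAlgebra.ι_sq_zero, map_zero]

/-- The span of the monomials `ω_S` with `S` independent and `⋂ S = X`. -/
def localPart (X : AffineSubspace ℂ W) : Submodule ℂ (OS A) :=
  Submodule.span ℂ {x | ∃ S, A.indep S ∧ A.inter S = X ∧ x = A.omB S}

/-- The span of the forms `Ξ(B)` with `B` an independent nbc set and `⋂ B = X`. -/
def nbcPart (X : AffineSubspace ℂ W) : Submodule ℂ (OS A) :=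
  Submodule.span ℂ {x | ∃ B, A.nbcSet 1 B ∧ A.indep B ∧ A.inter B = X ∧ x = A.Xi 1 lam B}

theorem omB_mem_localPart {S : Finset (Fin n)} (hS : A.indep S) :
    A.omB S ∈ A.localPart (A.inter S) :=
  Submodule.subset_span ⟨S, hS, rfl, rfl⟩

theorem exists_om_mul_omB (i : Fin n) (S : Finset (Fin n)) (hi : i ∉ S) :
    ∃ ε : ℂ, A.om i * A.omB S = ε • A.omB (insert i S) := by
  obtain ⟨ε, -, h⟩ := exists_gen_mul_eS i S hi
  exact ⟨ε, by rw [om, omB, ← map_mul, h, map_smul, omB]⟩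

theorem om_mul_omB_of_mem (i : Fin n) (S : Finset (Fin n)) (hi : i ∈ S) :
    A.om i * A.omB S = 0 := by
  rw [om, omB, ← map_mul, gen_mul_eS_of_mem i S hi, map_zero]

variable [FiniteDimensional ℂ W]

theorem om_mul_eq_zero {Z : AffineSubspace ℂ W} {i : Fin n} (hi : Z ≤ A.H i) {x : OS A}
    (hx : x ∈ A.localPart Z) : A.om i * x = 0 := by
  induction hx using Submodule.span_induction with
  | mem x hx =>
    obtain ⟨S, hS, rfl, rfl⟩ := hx
    by_cases hiS : i ∈ S
    · exact A.om_mul_omB_of_mem i S hiS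
    · obtain ⟨ε, h⟩ := A.exists_om_mul_omB i S hiS
      rw [h, A.omB_eq_zero_of_dep (A.dep_insert hS.1 hiS hi), smul_zero]
  | zero => rw [mul_zero]
  | add x y _ _ hx hy => rw [mul_add, hx, hy, add_zero]
  | smul c x _ hx => rw [mul_smul_comm, hx, smul_zero]

theorem om_mul_mem_localPart {Z : AffineSubspace ℂ W} {i : Fin n} (hi : ¬ Z ≤ A.H i) {x : OS A}
    (hx : x ∈ A.localPart Z) : A.om i * x ∈ A.localPart (Z ⊓ A.H i) := by
  induction hx using Submodule.span_induction with
  | mem x hx =>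
    obtain ⟨S, hS, rfl, rfl⟩ := hx
    obtain ⟨ε, h⟩ := A.exists_om_mul_omB i S fun hiS => hi (A.inter_le_H hiS)
    rw [h]
    refine Submodule.smul_mem _ _ ?_
    by_cases hb : A.inter (insert i S) = ⊥
    · rw [A.omB_eq_zero_of_inter_eq_bot hb]
      exact Submodule.zero_mem _
    · rw [← inter_insert]
      exact A.omB_mem_localPart (A.indep_insert hS hb hi)
  | zero => rw [mul_zero]; exact Submodule.zero_mem _
  | add x y _ _ hx hy => rw [mul_add]; exact Submodule.add_mem _ hx hy
  | smul c x _ hx => rw [mul_smul_comm]; exact Submodule.smul_mem _ _ hx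

theorem omLamX_mul_mem_localPart {Z : AffineSubspace ℂ W} {i : Fin n} (hZ : Z ≤ A.amb)
    (hi : ¬ Z ≤ A.H i) (hb : Z ⊓ A.H i ≠ ⊥) {x : OS A} (hx : x ∈ A.localPart Z) :
    A.omLamX lam (Z ⊓ A.H i) * x ∈ A.localPart (Z ⊓ A.H i) := by
  rw [omLamX, Finset.sum_mul]
  refine Submodule.sum_mem _ fun j hj => ?_
  rw [mem_sub] at hj
  rw [smul_mul_assoc]
  refine Submodule.smul_mem _ _ ?_
  by_cases hjZ : Z ≤ A.H j
  · rw [A.om_mul_eq_zero hjZ hx]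
    exact Submodule.zero_mem _
  · have hle : Z ⊓ A.H i ≤ Z ⊓ A.H j := le_inf inf_le_left hj
    have heq : Z ⊓ A.H i = Z ⊓ A.H j := by
      refine A.eq_of_le_of_cd_le hb hle (inf_le_left.trans hZ) ?_
      rw [A.cd_inf_H hZ hb hi, A.cd_inf_H hZ (ne_bot_of_le hb hle) hjZ]
    rw [heq]
    exact A.om_mul_mem_localPart hjZ hx

theorem Xi_mem_localPart {B : Finset (Fin n)} (hB : A.indep B) :
    A.Xi 1 lam B ∈ A.localPart (A.inter B) := by
  induction B using Finset.induction_on_min with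
  | empty =>
    rw [Xi_empty, ← omB_empty]
    exact A.omB_mem_localPart hB
  | insert m S hm ih =>
    have hmS : m ∉ S := fun h => lt_irrefl _ (hm m h)
    have hb := hB.1
    rw [A.Xi_insert_of_lt lam hm]
    rw [inter_insert] at hb ⊢
    exact A.omLamX_mul_mem_localPart lam (A.inter_le_amb S) (hB.not_le_H hmS) hb
      (ih (hB.subset (Finset.subset_insert m S)))

theorem osMk_contr_eS_eq_zero {X Y : AffineSubspace ℂ W} (hX : A.memL X)
    (hYX : A.sub Y ⊆ A.sub X)
    (hcd : A.cd (A.inter (A.sub Y)) + A.cd (A.inter (A.sub X \ A.sub Y)) = A.cd X)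
    {T : Finset (Fin n)} (hT : T ⊆ A.sub X) (hd : A.dep T) :
    A.osMk (contr (indForm (A.sub Y)) (eS T)) = 0 := by
  have hun : A.sub Y ∪ (A.sub X \ A.sub Y) = A.sub X := Finset.union_sdiff_of_subset hYX
  have hTu : T ∩ A.sub Y ∪ T \ A.sub Y = T := by
    rw [Finset.union_comm]
    exact Finset.sdiff_union_inter T (A.sub Y)
  obtain ⟨ε, hε, he⟩ := exists_eS_mul_eS (T ∩ A.sub Y) (T \ A.sub Y)
    (Finset.disjoint_sdiff_inter T (A.sub Y)).symm
  have h1 : contr (indForm (A.sub Y)) (eS (T \ A.sub Y)) = 0 := by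
    refine contr_eS_eq_zero _ _ fun i hi => ?_
    rw [indForm_single, if_neg (Finset.mem_sdiff.1 hi).2]
  have h2 : contr (indForm (A.sub Y)) (eS (T ∩ A.sub Y)) = bdry (T ∩ A.sub Y) := by
    refine contr_eS_eq_bdry _ _ fun i hi => ?_
    rw [indForm_single, if_pos (Finset.mem_inter.1 hi).2]
  have h3 := contr_mul_of_contr_eq_zero (indForm (A.sub Y)) (eS (T ∩ A.sub Y)) _ h1
  rw [he, map_smul, h2, hTu] at h3
  have h4 : ε • A.osMk (contr (indForm (A.sub Y)) (eS T)) = 0 := by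
    rw [← map_smul, h3, map_mul]
    rcases A.dep_of_dep_union (C := A.sub Y) (C' := A.sub X \ A.sub Y) (S := T ∩ A.sub Y)
      (T := T \ A.sub Y) (by rw [hun, A.inter_sub_eq hX]; exact hX.1)
      (by rw [hun, A.inter_sub_eq hX]; exact hcd) Finset.inter_subset_right
      (Finset.sdiff_subset_sdiff hT subset_rfl) (by rwa [hTu]) with h | h
    · rw [A.osMk_bdry_eq_zero h, zero_mul]
    · rw [← omB, A.omB_eq_zero_of_dep h, mul_zero]
  exact (smul_eq_zero.1 h4).resolve_left hε

/-- Exactness of multiplication by `ω_λ(X)` in top degree of `𝒜_X`, with an explicit primitive. -/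
theorem lamX_smul_omB {X Y : AffineSubspace ℂ W} (hX : A.memL X)
    (hYX : A.sub Y ⊆ A.sub X)
    (hcd : A.cd (A.inter (A.sub Y)) + A.cd (A.inter (A.sub X \ A.sub Y)) = A.cd X)
    {S : Finset (Fin n)} (hS : A.indep S) (hSX : A.inter S = X) :
    A.lamX lam Y • A.omB S =
      A.omLamX lam X * A.osMk (contr (indForm (A.sub Y)) (eS S)) := by
  have hSsub : S ⊆ A.sub X := fun i hi => A.mem_sub.2 (hSX ▸ A.inter_le_H hi)
  have key : ∀ i ∈ A.sub X, A.om i * A.osMk (contr (indForm (A.sub Y)) (eS S)) =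
      (if i ∈ A.sub Y then (1 : ℂ) else 0) • A.omB S := by
    intro i hi
    have h1 : A.osMk (contr (indForm (A.sub Y)) (gen i * eS S)) = 0 := by
      by_cases hiS : i ∈ S
      · rw [gen_mul_eS_of_mem i S hiS, map_zero, map_zero]
      · obtain ⟨ε, -, h⟩ := exists_gen_mul_eS i S hiS
        rw [h, map_smul, map_smul, A.osMk_contr_eS_eq_zero hX hYX hcd
          (Finset.insert_subset hi hSsub)
          (A.dep_insert hS.1 hiS (hSX ▸ A.mem_sub.1 hi)), smul_zero]
    rw [contr_gen_mul, map_sub, map_smul, map_mul, indForm_single, sub_eq_zero] at h1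
    exact h1.symm
  rw [omLamX, Finset.sum_mul, lamX, Finset.sum_smul, ← Finset.sum_subset hYX]
  · refine Finset.sum_congr rfl fun i hi => ?_
    rw [smul_mul_assoc, key i (hYX hi), if_pos hi, one_smul]
  · intro i hi hiY
    rw [smul_mul_assoc, key i hi, if_neg hiY, zero_smul, smul_zero]

theorem nbcSet_empty : A.nbcSet 1 ∅ := by
  refine ⟨A.indep_empty.1, ?_⟩
  rintro T hT ⟨i, -, -, hc⟩
  rw [Finset.subset_empty.1 hT] at hc
  refine (A.indep_insert A.indep_empty hc.1.1 ?_).not_dep hc.1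
  rw [inter_empty]
  exact A.amb_not_le_H i

theorem nbcSet_insert_min {m : Fin n} {B : Finset (Fin n)} (hB : A.nbcSet 1 B)
    (hb : A.inter (insert m B) ≠ ⊥)
    (hmin : ∀ i ∈ A.sub (A.inter (insert m B)), m ≤ i) : A.nbcSet 1 (insert m B) := by
  refine ⟨hb, fun T hT hbr => ?_⟩
  by_cases hmT : m ∈ T
  · obtain ⟨i, hiT, hlt, hc⟩ := hbr
    have hle : A.inter T ≤ A.H i := by
      by_contra hle
      have hT' : A.indep T := by
        refine (A.indep_or_dep ?_).resolve_right (hc.2 T (Finset.ssubset_insert hiT))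
        exact ne_bot_of_le hb (A.inter_anti hT)
      exact (A.indep_insert hT' hc.1.1 hle).not_dep hc.1
    exact (hlt m hmT).not_ge (hmin i (A.mem_sub.2 ((A.inter_anti hT).trans hle)))
  · exact hB.2 T ((Finset.subset_insert_iff_of_notMem hmT).1 hT) hbr

/-- The case of a flag not passing through the least hyperplane containing `X`. -/
theorem omLamX_mul_mem_nbcPart_of_not_le {X Y : AffineSubspace ℂ W} {m : Fin n} (hX : A.memL X)
    (hm : m ∈ A.sub X) (hmin : ∀ i ∈ A.sub X, m ≤ i) (hXY : X ≤ Y) (hY : A.memL Y)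
    (hcd : A.cd Y + 1 = A.cd X) (hmY : ¬ Y ≤ A.H m) {z : OS A} (hz : z ∈ A.nbcPart lam Y) :
    A.omLamX lam X * z ∈ A.nbcPart lam X := by
  induction hz using Submodule.span_induction with
  | mem z hz =>
    obtain ⟨B, hB, hBi, rfl, rfl⟩ := hz
    have hle : X ≤ A.inter (insert m B) := by
      rw [inter_insert]
      exact le_inf hXY (A.mem_sub.1 hm)
    have hb := ne_bot_of_le hX.1 hle
    have heq : X = A.inter (insert m B) := by
      refine A.eq_of_le_of_cd_le hX.1 hle (A.inter_le_amb _) ?_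
      rw [A.cd_inter_insert_of_not_le hb hmY, hcd]
    have hlt : ∀ j ∈ B, m < j := by
      intro j hj
      refine lt_of_le_of_ne (hmin j (A.mem_sub.2 (hXY.trans (A.inter_le_H hj)))) ?_
      rintro rfl
      exact hmY (A.inter_le_H hj)
    refine Submodule.subset_span ⟨insert m B, A.nbcSet_insert_min hB hb (heq ▸ hmin),
      A.indep_insert hBi hb hmY, heq.symm, ?_⟩
    rw [A.Xi_insert_of_lt lam hlt, ← heq]
  | zero => rw [mul_zero]; exact Submodule.zero_mem _
  | add x y _ _ hx hy => rw [mul_add]; exact Submodule.add_mem _ hx hy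
  | smul c x _ hx => rw [mul_smul_comm]; exact Submodule.smul_mem _ _ hx

theorem omLamX_mul_mem_nbcPart {X Y : AffineSubspace ℂ W} (hX : A.memL X) (hXne : X ≠ A.amb)
    (hXY : X ≤ Y) (hY : A.memL Y) (hcd : A.cd Y + 1 = A.cd X)
    (ih : ∀ Y', A.memL Y' → A.cd Y' + 1 = A.cd X → A.localPart Y' ≤ A.nbcPart lam Y')
    {z : OS A} (hz : z ∈ A.localPart Y) : A.omLamX lam X * z ∈ A.nbcPart lam X := by
  have hne : (A.sub X).Nonempty := by
    rw [Finset.nonempty_iff_ne_empty]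
    intro h
    have := A.inter_sub_eq hX
    rw [h, inter_empty] at this
    exact hXne this.symm
  obtain ⟨m, hm, hmin⟩ := Finset.exists_min_image (A.sub X) id hne
  replace hmin : ∀ i ∈ A.sub X, m ≤ i := hmin
  replace hz := ih Y hY hcd hz
  by_cases hmY : Y ≤ A.H m
  swap
  · exact A.omLamX_mul_mem_nbcPart_of_not_le lam hX hm hmin hXY hY hcd hmY hz
  induction hz using Submodule.span_induction with
  | mem z hz =>
    obtain ⟨B, hB, hBi, rfl, rfl⟩ := hz
    have hBm : ∀ j ∈ B, m ≤ j := fun j hj =>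
      hmin j (A.mem_sub.2 (hXY.trans (A.inter_le_H hj)))
    have hmB : m ∈ B := by
      by_contra hmB
      exact hB.not_forall_lt hBi hmY fun j hj =>
        lt_of_le_of_ne (hBm j hj) fun h => hmB (h ▸ hj)
    obtain ⟨B', hmB', rfl⟩ : ∃ B', m ∉ B' ∧ insert m B' = B :=
      ⟨B.erase m, Finset.notMem_erase m B, Finset.insert_erase hmB⟩
    have hlt : ∀ j ∈ B', m < j := fun j hj =>
      lt_of_le_of_ne (hBm j (Finset.mem_insert_of_mem hj)) fun h => hmB' (h ▸ hj)
    have hmZ : ¬ A.inter B' ≤ A.H m := hBi.not_le_H hmB'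
    have hB'i : A.indep B' := hBi.subset (Finset.subset_insert m B')
    have hx := A.Xi_mem_localPart lam hB'i
    have hYZ : A.inter (insert m B') ≤ A.inter B' := A.inter_anti (Finset.subset_insert m B')
    have hcdY := A.cd_inter_insert_of_not_le hBi.1 hmZ
    have hsub : A.sub (A.inter (insert m B')) ⊆ A.sub X := fun i hi =>
      A.mem_sub.2 (hXY.trans (A.mem_sub.1 hi))
    have hsplit : A.omLamX lam X = A.omLamX lam (A.inter (insert m B')) +
        ∑ i ∈ A.sub X \ A.sub (A.inter (insert m B')), lam i • A.om i := by
      rw [omLamX, omLamX, add_comm, Finset.sum_sdiff hsub]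
    have h0 : A.omLamX lam X * (A.omLamX lam X * A.Xi 1 lam B') = 0 := by
      rw [← mul_assoc, omLamX_mul_self, zero_mul]
    nth_rewrite 2 [hsplit] at h0
    rw [add_mul, mul_add] at h0
    rw [A.Xi_insert_of_lt lam hlt, eq_neg_of_add_eq_zero_left h0]
    refine Submodule.neg_mem _ ?_
    rw [Finset.sum_mul, Finset.mul_sum]
    refine Submodule.sum_mem _ fun i hi => ?_
    rw [smul_mul_assoc, mul_smul_comm]
    refine Submodule.smul_mem _ _ ?_
    rw [Finset.mem_sdiff, mem_sub, mem_sub] at hi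
    have hiZ : ¬ A.inter B' ≤ A.H i := fun h => hi.2 (hYZ.trans h)
    have hXi : X ≤ A.inter (insert i B') := by
      rw [inter_insert]
      exact le_inf (hXY.trans hYZ) hi.1
    have hib := ne_bot_of_le hX.1 hXi
    have hcdi := A.cd_inter_insert_of_not_le hib hiZ
    have hcdi' : A.cd (A.inter (insert i B')) + 1 = A.cd X := by omega
    refine A.omLamX_mul_mem_nbcPart_of_not_le lam hX hm hmin hXi (A.memL_inter hib) hcdi' ?_
      (ih _ (A.memL_inter hib) hcdi' ?_)
    · intro hmi
      apply hi.2
      have hle : A.inter (insert i B') ≤ A.inter (insert m B') := by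
        rw [A.inter_insert m]
        exact le_inf (A.inter_anti (Finset.subset_insert i B')) hmi
      rw [← A.eq_of_le_of_cd_le hib hle (A.inter_le_amb _) (by omega)]
      exact A.inter_le_H (Finset.mem_insert_self i B')
    · rw [inter_insert]
      exact A.om_mul_mem_localPart hiZ hx
  | zero => rw [mul_zero]; exact Submodule.zero_mem _
  | add x y _ _ hx hy => rw [mul_add]; exact Submodule.add_mem _ hx hy
  | smul c x _ hx => rw [mul_smul_comm]; exact Submodule.smul_mem _ _ hx

/-- If `λ(Y) ≠ 0` for all dense `Y ≠ V`, the forms `Ξ(B)` span the part of the Orlik–Solomon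
algebra supported at `X`. -/
theorem localPart_le_nbcPart
    (hlam : ∀ X, A.memL X → X ≠ A.amb → A.denseL X → A.lamX lam X ≠ 0)
    {X : AffineSubspace ℂ W} (hX : A.memL X) : A.localPart X ≤ A.nbcPart lam X := by
  induction hk : A.cd X using Nat.strong_induction_on generalizing X with
  | h k ih =>
    refine Submodule.span_le.2 ?_
    rintro _ ⟨S, hS, hSX, rfl⟩
    by_cases hXne : X = A.amb
    · have hS0 : S = ∅ := by
        rw [← Finset.card_eq_zero, ← hS.2, hSX, hXne, cd_amb]
      refine Submodule.subset_span ⟨S, ?_, hS, hSX, ?_⟩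
      · rw [hS0]
        exact A.nbcSet_empty
      · rw [hS0, omB_empty, Xi_empty]
    · obtain ⟨Y, hY, hYne, hYd, hYX, hcd⟩ := A.exists_dense_factor hX hXne
      have h1 := A.lamX_smul_omB lam hX hYX hcd hS hSX
      have hlY := hlam Y hY hYne hYd
      have h2 : A.omB S = (A.lamX lam Y)⁻¹ •
          (A.omLamX lam X * A.osMk (contr (indForm (A.sub Y)) (eS S))) := by
        rw [← h1, smul_smul, inv_mul_cancel₀ hlY, one_smul]
      rw [SetLike.mem_coe, h2, contr_eS, map_sum, Finset.mul_sum]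
      refine Submodule.smul_mem _ _ (Submodule.sum_mem _ fun i hi => ?_)
      rw [map_smul, mul_smul_comm, ← omB]
      refine Submodule.smul_mem _ _ ?_
      have hSi : A.indep (S.erase i) := hS.subset (Finset.erase_subset i S)
      have hcard := Finset.card_erase_add_one hi
      rw [← hSi.2, ← hS.2, hSX] at hcard
      refine A.omLamX_mul_mem_nbcPart lam hX hXne (hSX ▸ A.inter_anti (Finset.erase_subset i S))
        (A.memL_inter hSi.1) hcard ?_ (A.omB_mem_localPart hSi)
      intro Y' hY' hc
      exact ih (A.cd Y') (by omega) hY' rfl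

theorem span_Xi_nbcBase
    (hlam : ∀ X, A.memL X → X ≠ A.amb → A.denseL X → A.lamX lam X ≠ 0) :
    Submodule.span ℂ
      (Set.range fun B : {S : Finset (Fin n) // A.nbcBase 1 S} => A.Xi 1 lam B.1) =
      A.deg A.rank := by
  apply le_antisymm
  · rw [Submodule.span_le]
    rintro _ ⟨⟨B, hn, hB⟩, rfl⟩
    have hle : A.localPart (A.inter B) ≤ A.deg A.rank := by
      refine Submodule.span_mono ?_
      rintro _ ⟨S, hS, hSB, rfl⟩
      exact ⟨S, by rw [← hS.2, hSB, hB.1.2, hB.card_eq_rank], rfl⟩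
    exact hle (A.Xi_mem_localPart lam hB.1)
  · refine Submodule.span_le.2 ?_
    rintro _ ⟨S, hS, rfl⟩
    rw [SetLike.mem_coe]
    by_cases hb : A.inter S = ⊥
    · rw [A.omB_eq_zero_of_inter_eq_bot hb]
      exact Submodule.zero_mem _
    rcases A.indep_or_dep hb with hi | hd
    · refine (?_ : A.nbcPart lam (A.inter S) ≤ _)
        (A.localPart_le_nbcPart lam hlam (A.memL_inter hb) (A.omB_mem_localPart hi))
      refine Submodule.span_mono ?_
      rintro _ ⟨B, hn, hB, hBS, rfl⟩
      exact ⟨⟨B, hn, A.isBase_of_card_eq_rank hB (by rw [← hB.2, hBS, hi.2, hS])⟩, rfl⟩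
    · rw [A.omB_eq_zero_of_dep hd]
      exact Submodule.zero_mem _

theorem linearIndependent_Xi_nbcBase
    (hlam : ∀ X, A.memL X → X ≠ A.amb → A.denseL X → A.lamX lam X ≠ 0) :
    LinearIndependent ℂ
      fun B : {S : Finset (Fin n) // A.nbcBase 1 S} => A.Xi 1 lam B.1 := by
  classical
  have : Fintype {S : Finset (Fin n) // A.nbcBase 1 S} := Fintype.ofFinite _
  have hle : Submodule.span ℂ
      (Set.range fun B : {S : Finset (Fin n) // A.nbcBase 1 S} => A.omB B.1) ≤
      Submodule.span ℂ
        (Set.range fun B : {S : Finset (Fin n) // A.nbcBase 1 S} => A.Xi 1 lam B.1) := by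
    rw [A.span_Xi_nbcBase lam hlam]
    refine Submodule.span_mono ?_
    rintro _ ⟨B, rfl⟩
    exact ⟨B.1, B.2.2.card_eq_rank, rfl⟩
  have hfin := FiniteDimensional.span_of_finite ℂ (Set.finite_range
    fun B : {S : Finset (Fin n) // A.nbcBase 1 S} => A.Xi 1 lam B.1)
  rw [linearIndependent_iff_card_le_finrank_span,
    ← finrank_span_eq_card A.linearIndependent_omB_nbcBase]
  exact Submodule.finrank_mono hle

end Spanning

end HArr

open scoped Classical
/-- If `λ(X) ≠ 0` for every dense `X ∈ L ∖ {V}`, then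
`{Ξ(B) : B ∈ nbc}` is a ℂ-basis of `A^r`. -/
theorem Xi_nbc_basis_top_degree {W : Type} [AddCommGroup W] [Module ℂ W]
    [FiniteDimensional ℂ W] {n : ℕ} (A : HArr W n) (lam : Fin n → ℂ)
    (hlam : ∀ X, A.memL X → X ≠ A.amb → A.denseL X → A.lamX lam X ≠ 0) :
    LinearIndependent ℂ
      (fun B : {S : Finset (Fin n) // A.nbcBase 1 S} => A.Xi 1 lam B.1) ∧
    Submodule.span ℂ
      (Set.range fun B : {S : Finset (Fin n) // A.nbcBase 1 S} => A.Xi 1 lam B.1) =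
      A.deg A.rank := by
  exact ⟨A.linearIndependent_Xi_nbcBase lam hlam, A.span_Xi_nbcBase lam hlam⟩
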